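/- Let 1 < γ < 2 and J ≥ 0, and let R : (0,∞) → [0,∞) be measurable and integrable on (0,T) for every T > 0, with lim_{t→∞} t^γ R(t) = J. Then (i) lim_{t→∞} t^{γ−2} ∫_0^t ∫_0^t R(s+u) ds du = J(2−2^{2−γ})/((2−γ)(γ−1)), and (ii) lim_{t→∞} t^{γ−2} ∫_0^t ∫_0^t R(s+u+t) ds du = J(2·2^{2−γ}−3^{2−γ}−1)/((2−γ)(γ−1)). -/

import Mathlib

open MeasureTheory Filter Topology

lemma aux_eps (q L : ℝ) (f : ℝ → ℝ) (h : Tendsto (fun t : ℝ => t ^ q * f t) atTop (𝓝 L))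
    (ε : ℝ) (hε : 0 < ε) :
    ∃ A > 0, ∀ x ≥ A, |f x - L * x ^ (-q)| ≤ ε * x ^ (-q) := by
  obtain ⟨A, hA⟩ := Filter.eventually_atTop.1 (Metric.tendsto_nhds.1 h ε hε)
  refine ⟨max A 1, by positivity, fun x hx => ?_⟩
  have hx0 : 0 < x := lt_of_lt_of_le (by positivity) hx
  have h1 := hA x (le_trans (le_max_left _ _) hx)
  rw [Real.dist_eq] at h1
  have hp : 0 < x ^ (-q) := Real.rpow_pos_of_pos hx0 _
  have hm : x ^ q * x ^ (-q) = 1 := by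
    rw [← Real.rpow_add hx0]; simp
  have : f x - L * x ^ (-q) = (x ^ q * f x - L) * x ^ (-q) := by
    linear_combination (- f x) * hm
  rw [this, abs_mul, abs_of_pos hp]
  exact mul_le_mul_of_nonneg_right h1.le hp.le

lemma aux_tail (γ J : ℝ) (hγ1 : 1 < γ) (S : ℝ → ℝ) (hS : Integrable S)
    (hlim : Tendsto (fun t : ℝ => t ^ γ * S t) atTop (𝓝 J)) :
    Tendsto (fun t : ℝ => t ^ (γ - 1) * ∫ x in Set.Ioi t, S x) atTop (𝓝 (J / (γ - 1))) := by
  rw [Metric.tendsto_nhds]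
  intro η hη
  have hg : 0 < γ - 1 := by linarith
  obtain ⟨A, hA0, hA⟩ := aux_eps γ J S hlim (η * (γ - 1) / 2) (by positivity)
  filter_upwards [eventually_ge_atTop A] with t ht
  have ht0 : 0 < t := lt_of_lt_of_le hA0 ht
  have hi := integrableOn_Ioi_rpow_of_lt (a := -γ) (by linarith) ht0
  have hv := integral_Ioi_rpow_of_lt (a := -γ) (by linarith) ht0
  have hv' : ∫ x in Set.Ioi t, x ^ (-γ) = t ^ (1 - γ) / (γ - 1) := by
    rw [hv, show -γ + 1 = 1 - γ by ring, neg_div, ← div_neg]; congr 1; ring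
  have hb : ‖∫ x in Set.Ioi t, (S x - J * x ^ (-γ))‖ ≤
      ∫ x in Set.Ioi t, (η * (γ - 1) / 2) * x ^ (-γ) := by
    refine norm_integral_le_of_norm_le (hi.const_mul _) ?_
    refine (ae_restrict_iff' measurableSet_Ioi).2 (Eventually.of_forall fun x hx => ?_)
    exact hA x (ht.trans (le_of_lt hx))
  rw [integral_sub hS.integrableOn (hi.const_mul _), integral_const_mul, integral_const_mul,
    hv', Real.norm_eq_abs] at hb
  have hm : t ^ (γ - 1) * t ^ (1 - γ) = 1 := by
    rw [← Real.rpow_add ht0]; simp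
  have hp : 0 < t ^ (γ - 1) := Real.rpow_pos_of_pos ht0 _
  rw [Real.dist_eq]
  have e : t ^ (γ - 1) * (∫ x in Set.Ioi t, S x) - J / (γ - 1) =
      t ^ (γ - 1) * ((∫ x in Set.Ioi t, S x) - J * (t ^ (1 - γ) / (γ - 1))) := by
    linear_combination (J / (γ - 1)) * hm
  rw [e, abs_mul, abs_of_pos hp]
  calc _ ≤ t ^ (γ - 1) * (η * (γ - 1) / 2 * (t ^ (1 - γ) / (γ - 1))) :=
        mul_le_mul_of_nonneg_left hb hp.le
    _ = (t ^ (γ - 1) * t ^ (1 - γ)) * (η / 2) := by field_simp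
    _ < η := by rw [hm]; linarith

lemma aux_prim (p L : ℝ) (hp0 : 0 < p) (hp1 : p < 1) (H : ℝ → ℝ) (hH : Continuous H)
    (hlim : Tendsto (fun t : ℝ => t ^ p * H t) atTop (𝓝 L)) :
    Tendsto (fun t : ℝ => t ^ (p - 1) * ∫ x in (0:ℝ)..t, H x) atTop (𝓝 (L / (1 - p))) := by
  rw [Metric.tendsto_nhds]
  intro η hη
  have hg : 0 < 1 - p := by linarith
  obtain ⟨A, hA0, hA⟩ := aux_eps p L H hlim (η * (1 - p) / 2) (by positivity)
  have hi : ∀ a b : ℝ, IntervalIntegrable (fun x : ℝ => x ^ (-p)) volume a b := fun a b =>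
    intervalIntegral.intervalIntegrable_rpow' (by linarith)
  have hHi : ∀ a b : ℝ, IntervalIntegrable H volume a b := fun a b => hH.intervalIntegrable a b
  have hD : ∀ a b : ℝ, IntervalIntegrable (fun x => H x - L * x ^ (-p)) volume a b :=
    fun a b => (hHi a b).sub ((hi a b).const_mul _)
  set C := |∫ x in (0:ℝ)..A, (H x - L * x ^ (-p))| with hC
  have hz : Tendsto (fun t : ℝ => C * t ^ (p - 1)) atTop (𝓝 0) := by
    have := (tendsto_rpow_neg_atTop hg).const_mul C
    simpa using this
  filter_upwards [eventually_ge_atTop A, hz.eventually_lt_const (half_pos hη)] with t ht hCt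
  have ht0 : 0 < t := lt_of_lt_of_le hA0 ht
  have hv : ∀ a : ℝ, ∫ x in a..t, x ^ (-p) = (t ^ (1 - p) - a ^ (1 - p)) / (1 - p) := fun a => by
    rw [integral_rpow (Or.inl (by linarith)), show -p + 1 = 1 - p by ring]
  have hb : ‖∫ x in A..t, (H x - L * x ^ (-p))‖ ≤
      ∫ x in A..t, (η * (1 - p) / 2) * x ^ (-p) := by
    refine intervalIntegral.norm_integral_le_of_norm_le ht ?_ ((hi _ _).const_mul _)
    exact Eventually.of_forall fun x hx => hA x hx.1.le
  rw [intervalIntegral.integral_const_mul, hv, Real.norm_eq_abs] at hb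
  have hs := intervalIntegral.integral_add_adjacent_intervals (hD 0 A) (hD A t)
  have hs2 : ∫ x in (0:ℝ)..t, (H x - L * x ^ (-p)) =
      (∫ x in (0:ℝ)..t, H x) - L * (t ^ (1 - p) / (1 - p)) := by
    rw [intervalIntegral.integral_sub (hHi _ _) ((hi _ _).const_mul _),
      intervalIntegral.integral_const_mul, hv, Real.zero_rpow hg.ne', sub_zero]
  have hAp : 0 < A ^ (1 - p) := Real.rpow_pos_of_pos hA0 _
  have hb2 : |(∫ x in (0:ℝ)..t, H x) - L * (t ^ (1 - p) / (1 - p))| ≤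
      C + η / 2 * t ^ (1 - p) := by
    rw [← hs2, ← hs]
    refine (abs_add_le _ _).trans (add_le_add le_rfl (hb.trans ?_))
    have : η * (1 - p) / 2 * ((t ^ (1 - p) - A ^ (1 - p)) / (1 - p)) =
      η / 2 * (t ^ (1 - p) - A ^ (1 - p)) := by field_simp
    rw [this]
    exact mul_le_mul_of_nonneg_left (by linarith) (by linarith)
  have hm : t ^ (p - 1) * t ^ (1 - p) = 1 := by
    rw [← Real.rpow_add ht0]; simp
  have hp : 0 < t ^ (p - 1) := Real.rpow_pos_of_pos ht0 _
  rw [Real.dist_eq]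
  have e : t ^ (p - 1) * (∫ x in (0:ℝ)..t, H x) - L / (1 - p) =
      t ^ (p - 1) * ((∫ x in (0:ℝ)..t, H x) - L * (t ^ (1 - p) / (1 - p))) := by
    linear_combination (L / (1 - p)) * hm
  rw [e, abs_mul, abs_of_pos hp]
  calc _ ≤ t ^ (p - 1) * (C + η / 2 * t ^ (1 - p)) := mul_le_mul_of_nonneg_left hb2 hp.le
    _ = C * t ^ (p - 1) + (t ^ (p - 1) * t ^ (1 - p)) * (η / 2) := by ring
    _ < η := by rw [hm]; linarith

lemma aux_scale (q M c : ℝ) (hc : 0 < c) (K : ℝ → ℝ)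
    (h : Tendsto (fun t : ℝ => t ^ (-q) * K t) atTop (𝓝 M)) :
    Tendsto (fun t : ℝ => t ^ (-q) * K (c * t)) atTop (𝓝 (c ^ q * M)) := by
  have h1 := (h.comp (tendsto_id.const_mul_atTop hc)).const_mul (c ^ q)
  refine h1.congr' ?_
  filter_upwards [eventually_gt_atTop 0] with t ht
  simp only [Function.comp, id]
  rw [Real.mul_rpow hc.le ht.le]
  have hm : c ^ q * c ^ (-q) = 1 := by
    rw [← Real.rpow_add hc]; simp
  linear_combination (t ^ (-q) * K (c * t)) * hm

theorem stmt2 (γ J : ℝ) (hγ1 : 1 < γ) (hγ2 : γ < 2) (hJ : 0 ≤ J)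
    (R : ℝ → ℝ) (hmeas : Measurable R) (hnonneg : ∀ t > 0, 0 ≤ R t)
    (hint : ∀ T > 0, IntegrableOn R (Set.Ioo (0:ℝ) T))
    (hlim : Tendsto (fun t : ℝ => t ^ γ * R t) atTop (𝓝 J)) :
    Tendsto (fun t : ℝ => t ^ (γ - 2) * ∫ u in (0:ℝ)..t, ∫ s in (0:ℝ)..t, R (s + u)) atTop
      (𝓝 (J * (2 - (2:ℝ) ^ (2 - γ)) / ((2 - γ) * (γ - 1)))) ∧
    Tendsto (fun t : ℝ => t ^ (γ - 2) * ∫ u in (0:ℝ)..t, ∫ s in (0:ℝ)..t, R (s + u + t)) atTop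
      (𝓝 (J * (2 * (2:ℝ) ^ (2 - γ) - (3:ℝ) ^ (2 - γ) - 1) / ((2 - γ) * (γ - 1)))) := by
  have hRi : IntegrableOn R (Set.Ioi 0) := by
    obtain ⟨A, hA0, hA⟩ := aux_eps γ J R hlim 1 one_pos
    have h1 : IntegrableOn R (Set.Ioc 0 A) :=
      (integrableOn_Ioc_iff_integrableOn_Ioo (by finiteness)).2 (hint A hA0)
    have h2 : IntegrableOn R (Set.Ioi A) := by
      have hi := integrableOn_Ioi_rpow_of_lt (a := -γ) (by linarith) hA0
      refine Integrable.mono' (hi.const_mul (J + 1)) hmeas.aestronglyMeasurable ?_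
      refine (ae_restrict_iff' measurableSet_Ioi).2 (Eventually.of_forall fun x hx => ?_)
      have hx' : A < x := hx
      have h3 := (abs_le.1 (hA x hx'.le)).2
      rw [Real.norm_eq_abs, abs_of_nonneg (hnonneg x (hA0.trans hx'))]
      linarith
    rw [← Set.Ioc_union_Ioi_eq_Ioi hA0.le]
    exact h1.union h2
  set S : ℝ → ℝ := (Set.Ioi (0:ℝ)).indicator R with hSdef
  have hS : Integrable S := hRi.integrable_indicator measurableSet_Ioi
  have hSR : ∀ x : ℝ, 0 < x → R x = S x := fun x hx => by
    rw [hSdef, Set.indicator_of_mem (Set.mem_Ioi.2 hx)]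
  have hlimS : Tendsto (fun t : ℝ => t ^ γ * S t) atTop (𝓝 J) := by
    refine hlim.congr' ?_
    filter_upwards [eventually_gt_atTop 0] with t ht
    rw [hSR t ht]
  set H : ℝ → ℝ := fun t => ∫ x in Set.Ioi t, S x with hHdef
  have hHd : ∀ a b : ℝ, ∫ x in a..b, S x = H a - H b := fun a b =>
    (intervalIntegral.integral_Ioi_sub_Ioi' hS.integrableOn hS.integrableOn).symm
  have hHc : Continuous H := by
    have h1 := intervalIntegral.continuous_primitive
      (fun a b => hS.intervalIntegrable (a := a) (b := b)) 0
    have h2 : H = fun b => H 0 - ∫ x in (0:ℝ)..b, S x := by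
      funext b; rw [hHd]; ring
    rw [h2]
    exact continuous_const.sub h1
  have hHi : ∀ a b : ℝ, IntervalIntegrable H volume a b := fun a b => hHc.intervalIntegrable a b
  set K : ℝ → ℝ := fun t => ∫ x in (0:ℝ)..t, H x with hKdef
  have hKd : ∀ a b : ℝ, ∫ x in a..b, H x = K b - K a := fun a b =>
    (intervalIntegral.integral_interval_sub_left (hHi _ _) (hHi _ _)).symm
  have hK : Tendsto (fun t : ℝ => t ^ (-(2 - γ)) * K t) atTop
      (𝓝 (J / (γ - 1) / (2 - γ))) := by
    have := aux_prim (γ - 1) _ (by linarith) (by linarith) H hHc (aux_tail γ J hγ1 S hS hlimS)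
    rw [show γ - 1 - 1 = -(2 - γ) by ring, show 1 - (γ - 1) = 2 - γ by ring] at this
    exact this
  have hK2 := aux_scale _ _ 2 two_pos K hK
  have hK3 := aux_scale _ _ 3 three_pos K hK
  -- the general double integral
  have key : ∀ t > 0, ∀ c ≥ 0, ∫ u in (0:ℝ)..t, ∫ s in (0:ℝ)..t, R (s + u + c) =
      (K (t + c) - K c) - (K (t + (t + c)) - K (t + c)) := by
    intro t ht c hc
    have h1 : ∀ u ∈ Set.uIcc 0 t, ∫ s in (0:ℝ)..t, R (s + u + c) =
        H (u + c) - H (u + (t + c)) := by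
      intro u hu
      rw [Set.uIcc_of_le ht.le] at hu
      have : ∫ s in (0:ℝ)..t, R (s + u + c) = ∫ s in (0:ℝ)..t, S (s + (u + c)) := by
        refine intervalIntegral.integral_congr_ae (Eventually.of_forall fun s hs => ?_)
        rw [Set.uIoc_of_le ht.le] at hs
        rw [hSR _ (by linarith [hs.1, hu.1]), add_assoc]
      rw [this, intervalIntegral.integral_comp_add_right (fun x => S x), hHd, zero_add]
      congr 2; ring
    have hsh : ∀ d : ℝ, IntervalIntegrable (fun x => H (x + d)) volume 0 t := fun d =>
      (hHc.comp (continuous_id.add continuous_const)).intervalIntegrable _ _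
    rw [intervalIntegral.integral_congr h1, intervalIntegral.integral_sub (hsh _) (hsh _),
      intervalIntegral.integral_comp_add_right (fun x => H x),
      intervalIntegral.integral_comp_add_right (fun x => H x), hKd, hKd, zero_add, zero_add]
  have hne1 : γ - 1 ≠ 0 := by linarith
  have hne2 : 2 - γ ≠ 0 := by linarith
  have hK0 : K 0 = 0 := intervalIntegral.integral_same
  constructor
  · have h := (hK.const_mul 2).sub hK2
    have e : 2 * (J / (γ - 1) / (2 - γ)) - 2 ^ (2 - γ) * (J / (γ - 1) / (2 - γ)) =
        J * (2 - (2:ℝ) ^ (2 - γ)) / ((2 - γ) * (γ - 1)) := by field_simp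
    rw [e] at h
    refine h.congr' ?_
    filter_upwards [eventually_gt_atTop 0] with t ht
    have hk := key t ht 0 le_rfl
    simp only [add_zero, hK0] at hk
    rw [hk, show t + t = 2 * t by ring, show -(2 - γ) = γ - 2 by ring]
    ring
  · have h := ((hK2.const_mul 2).sub hK3).sub hK
    have e : 2 * (2 ^ (2 - γ) * (J / (γ - 1) / (2 - γ))) - 3 ^ (2 - γ) * (J / (γ - 1) / (2 - γ))
        - J / (γ - 1) / (2 - γ) =
        J * (2 * (2:ℝ) ^ (2 - γ) - (3:ℝ) ^ (2 - γ) - 1) / ((2 - γ) * (γ - 1)) := by field_simp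
    rw [e] at h
    refine h.congr' ?_
    filter_upwards [eventually_gt_atTop 0] with t ht
    have hk := key t ht t ht.le
    rw [hk, show t + (t + t) = 3 * t by ring, show t + t = 2 * t by ring,
      show -(2 - γ) = γ - 2 by ring]
    ring
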